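/- Let ℓ ≥ 1 and m ≥ 0 be integers, and let x₀, v be real numbers with r² := x₀² + v² ≠ 0. Then Re( Σ_{j=0}^{2m+1} C(ℓ+j−1, ℓ−1)·C(2m+ℓ−j, ℓ−1)·(x₀+iv)^{2m+1−j}·(x₀−iv)^{j} ) = ((−1)^m·√π·Γ(m+ℓ+1)·x₀·r^{2m} / (Γ(ℓ)·Γ(m+3/2))) · P_m^{(1/2, (2ℓ−1)/2)}(1 − 2x₀²/r²), where Γ is the real Gamma function and the Jacobi polynomial P_n^{(α,β)} is given by its explicit formula P_n^{(α,β)}(z) = (Γ(α+n+1)/(n!·Γ(n+α+β+1)))·Σ_{ν=0}^{n} C(n,ν)·(Γ(n+α+β+ν+1)/Γ(α+ν+1))·((z−1)/2)^ν. (Proposition 5.5 of the paper, even case: H_ℓ^{2m+2ℓ}(x) expressed through Jacobi polynomials.) -/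

import Mathlib

/-- The Jacobi polynomials, given by the explicit formula
`P_n^{(α,β)}(z) = (Γ(α+n+1)/(n! Γ(n+α+β+1))) ∑_{ν=0}^n C(n,ν) (Γ(n+α+β+ν+1)/Γ(α+ν+1)) ((z-1)/2)^ν`. -/
noncomputable def jacobiP (n : ℕ) (α β z : ℝ) : ℝ :=
  Real.Gamma (α + n + 1) / (Nat.factorial n * Real.Gamma (n + α + β + 1)) *
    ∑ ν ∈ Finset.range (n + 1),
      (Nat.choose n ν : ℝ) * (Real.Gamma (n + α + β + ν + 1) / Real.Gamma (α + ν + 1)) *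
        ((z - 1) / 2) ^ ν

open PowerSeries in
/-- The coefficients of the powers of a polynomial `s X + q X²` without constant term. -/
lemma coeff_C_mul_X_add_C_mul_X_sq_pow {R : Type*} [CommRing R] (s q : R) (n N : ℕ) :
    coeff N ((C s * X + C q * X ^ 2 : R⟦X⟧) ^ n) =
      if n ≤ N then (n.choose (N - n) : R) * s ^ (2 * n - N) * q ^ (N - n) else 0 := by
  have key : (C s * X + C q * X ^ 2 : R⟦X⟧) ^ n =
      (∑ i ∈ Finset.range (n + 1), C (q ^ i * s ^ (n - i) * n.choose i) * X ^ i) * X ^ n := by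
    rw [show (C s * X + C q * X ^ 2 : R⟦X⟧) = (C q * X + C s) * X by ring, mul_pow, add_pow]
    congr 1
    refine Finset.sum_congr rfl fun i _ => ?_
    simp only [map_mul, map_pow, map_natCast]
    ring
  rw [key, coeff_mul_X_pow']
  split_ifs with hn
  swap
  · rfl
  simp only [map_sum, coeff_C_mul, coeff_X_pow, mul_ite, mul_one, mul_zero, Finset.sum_ite_eq,
    Finset.mem_range]
  split_ifs with h
  · rw [show n - (N - n) = 2 * n - N by lia]
    ring
  · rw [Nat.choose_eq_zero_of_lt (by lia)]
    simp

open PowerSeries in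
/-- The two expansions of the coefficients of `((1 - a X) (1 - b X)) ^ (-(d + 1))`. -/
lemma sum_choose_mul_choose_mul_pow_mul_pow {R : Type*} [CommRing R] (d N : ℕ) (a b : R) :
    ∑ j ∈ Finset.range (N + 1),
        ((d + j).choose d : R) * ((d + (N - j)).choose d : R) * a ^ (N - j) * b ^ j =
      ∑ n ∈ Finset.range (N + 1), ((d + n).choose d : R) *
        ((n.choose (N - n) : R) * (a + b) ^ (2 * n - N) * (-(a * b)) ^ (N - n)) := by
  set F : R⟦X⟧ := mk fun n => ((d + n).choose d : R) with hF
  have hF1 : F * (1 - X) ^ (d + 1) = 1 := mk_add_choose_mul_one_sub_pow_eq_one R d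
  set Q : R⟦X⟧ := C (a + b) * X + C (-(a * b)) * X ^ 2 with hQ
  have hQs : HasSubst Q := HasSubst.of_constantCoeff_zero' (by simp [hQ])
  have h_subst : F.subst Q * (1 - Q) ^ (d + 1) = 1 := by
    have := congrArg (substAlgHom (R := R) hQs) hF1
    simpa only [map_mul, map_pow, map_sub, map_one, coe_substAlgHom, subst_X hQs] using this
  have h_scale (c : R) : rescale c F * (1 - C c * X) ^ (d + 1) = 1 := by
    have := congrArg (rescale c) hF1
    simpa only [map_mul, map_pow, map_sub, map_one, rescale_X] using this
  have h_factor : (1 - C b * X) * (1 - C a * X) = (1 - Q : R⟦X⟧) := by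
    simp only [hQ, map_add, map_neg, map_mul]
    ring
  have h_eq : rescale b F * rescale a F = F.subst Q := by
    have h_prod : (rescale b F * rescale a F) * (1 - Q) ^ (d + 1) = 1 := by
      rw [← h_factor, mul_pow, mul_mul_mul_comm, h_scale, h_scale, one_mul]
    exact left_inv_eq_right_inv h_prod ((mul_comm _ _).trans h_subst)
  have h_coeff := congrArg (coeff N) h_eq
  rw [coeff_mul, Finset.Nat.sum_antidiagonal_eq_sum_range_succ_mk, coeff_subst' hQs,
    finsum_eq_sum_of_support_subset (s := Finset.range (N + 1))] at h_coeff
  · simp only [coeff_rescale, hF, coeff_mk, smul_eq_mul, hQ,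
      coeff_C_mul_X_add_C_mul_X_sq_pow] at h_coeff
    refine Eq.trans (Finset.sum_congr rfl fun j _ => ?_)
      (h_coeff.trans (Finset.sum_congr rfl fun n hn => ?_))
    · ring
    · rw [if_pos (Nat.lt_succ_iff.mp (Finset.mem_range.mp hn))]
  · intro n hn
    by_contra h
    refine hn ?_
    simp only [Finset.coe_range, Set.mem_Iio, not_lt] at h
    simp only [hQ, coeff_C_mul_X_add_C_mul_X_sq_pow]
    rw [if_neg (by lia), smul_zero]

/-- The values of `Γ` at `k + 3/2`, in terms of factorials. -/
lemma Real.Gamma_nat_add_three_half (k : ℕ) :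
    Real.Gamma (k + 3 / 2) * (2 ^ (2 * k + 1) * k.factorial) =
      (2 * k + 1).factorial * Real.sqrt Real.pi := by
  induction k with
  | zero =>
    have h := Real.Gamma_add_one (s := 1 / 2) (by norm_num)
    rw [Real.Gamma_one_half_eq] at h
    norm_num at h ⊢
    rw [h]
    ring
  | succ k ih =>
    have h := Real.Gamma_add_one (s := (k : ℝ) + 3 / 2) (by positivity)
    rw [show ((k + 1 : ℕ) : ℝ) + 3 / 2 = k + 3 / 2 + 1 by push_cast; ring, h,
      show 2 * (k + 1) + 1 = 2 * k + 1 + 1 + 1 by ring]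
    simp only [Nat.factorial_succ (2 * k + 1 + 1), Nat.factorial_succ (2 * k + 1),
      Nat.factorial_succ k, pow_succ _ (2 * k + 1 + 1), pow_succ _ (2 * k + 1)]
    push_cast
    linear_combination (4 * ((k : ℝ) + 3 / 2) * (k + 1)) * ih

/-- **Proposition 5.5, even case.** The polynomial `H_ℓ^{2m+2ℓ}(x)` (computed by substituting
`x₀ + iv` for `x` and `x₀ - iv` for `x̄` and taking the real part, with `r² = x₀² + v²`) equals
`(-1)^m √π Γ(m+ℓ+1) x₀ r^{2m} / (Γ(ℓ) Γ(m+3/2)) · P_m^{(1/2,(2ℓ-1)/2)}(1 - 2x₀²/r²)`. -/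
theorem Hpoly_even_eq_jacobi (ℓ m : ℕ) (hℓ : 1 ≤ ℓ) (x₀ v : ℝ) (h : x₀ ^ 2 + v ^ 2 ≠ 0) :
    (∑ j ∈ Finset.range (2 * m + 2),
      ((Nat.choose (ℓ - 1 + j) (ℓ - 1) * Nat.choose (2 * m + ℓ - j) (ℓ - 1) : ℕ) : ℂ) *
        ((x₀ : ℂ) + (v : ℂ) * Complex.I) ^ (2 * m + 1 - j) *
        ((x₀ : ℂ) - (v : ℂ) * Complex.I) ^ j).re =
      (-1) ^ m * Real.sqrt Real.pi * Real.Gamma ((m : ℝ) + ℓ + 1) * x₀ * (x₀ ^ 2 + v ^ 2) ^ m /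
          (Real.Gamma ℓ * Real.Gamma ((m : ℝ) + 3 / 2)) *
        jacobiP m (1 / 2) ((2 * (ℓ : ℝ) - 1) / 2) (1 - 2 * x₀ ^ 2 / (x₀ ^ 2 + v ^ 2)) := by
  obtain ⟨d, rfl⟩ : ∃ d, ℓ = d + 1 := ⟨ℓ - 1, by lia⟩
  have h_lhs : (∑ j ∈ Finset.range (2 * m + 2),
      ((Nat.choose (d + 1 - 1 + j) (d + 1 - 1) *
          Nat.choose (2 * m + (d + 1) - j) (d + 1 - 1) : ℕ) : ℂ) *
        ((x₀ : ℂ) + (v : ℂ) * Complex.I) ^ (2 * m + 1 - j) *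
        ((x₀ : ℂ) - (v : ℂ) * Complex.I) ^ j) =
      ((∑ n ∈ Finset.range (2 * m + 1 + 1), ((d + n).choose d : ℝ) *
        ((n.choose (2 * m + 1 - n) : ℝ) * (2 * x₀) ^ (2 * n - (2 * m + 1)) *
          (-(x₀ ^ 2 + v ^ 2)) ^ (2 * m + 1 - n)) : ℝ) : ℂ) := by
    have h_add : (x₀ : ℂ) + v * Complex.I + (x₀ - v * Complex.I) = 2 * x₀ := by ring
    have h_mul : ((x₀ : ℂ) + v * Complex.I) * (x₀ - v * Complex.I) = x₀ ^ 2 + v ^ 2 := by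
      linear_combination (-(v : ℂ) ^ 2) * Complex.I_sq
    push_cast
    rw [← h_add, ← h_mul, ← sum_choose_mul_choose_mul_pow_mul_pow]
    refine Finset.sum_congr rfl fun j hj => ?_
    rw [Finset.mem_range] at hj
    rw [show 2 * m + (d + 1) - j = d + (2 * m + 1 - j) by lia]
  have h_low : ∑ n ∈ Finset.range (m + 1), ((d + n).choose d : ℝ) *
        ((n.choose (2 * m + 1 - n) : ℝ) * (2 * x₀) ^ (2 * n - (2 * m + 1)) *
          (-(x₀ ^ 2 + v ^ 2)) ^ (2 * m + 1 - n)) = 0 := by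
    refine Finset.sum_eq_zero fun n hn => ?_
    rw [Finset.mem_range] at hn
    rw [Nat.choose_eq_zero_of_lt (by lia : n < 2 * m + 1 - n)]
    simp
  rw [h_lhs, Complex.ofReal_re, show 2 * m + 1 + 1 = (m + 1) + (m + 1) by ring,
    Finset.sum_range_add, h_low, zero_add, jacobiP, Finset.mul_sum, Finset.mul_sum]
  refine Finset.sum_congr rfl fun ν hν => ?_
  obtain ⟨k, rfl⟩ : ∃ k, m = ν + k := ⟨m - ν, by rw [Finset.mem_range] at hν; lia⟩
  rw [show 2 * (ν + k) + 1 - (ν + k + 1 + ν) = k by lia,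
    show 2 * (ν + k + 1 + ν) - (2 * (ν + k) + 1) = 2 * ν + 1 by lia,
    show ν + k + 1 + ν = k + (2 * ν + 1) by ring]
  simp only [Nat.cast_add_choose]
  have hΓ₁ : Real.Gamma ((ν + k : ℕ) + (d + 1 : ℕ) + 1) = ((ν + k + d + 1).factorial : ℝ) := by
    rw [← Real.Gamma_nat_eq_factorial]
    push_cast
    ring_nf
  have hΓ₂ : Real.Gamma ((ν + k : ℕ) + 1 / 2 + (2 * ((d + 1 : ℕ) : ℝ) - 1) / 2 + 1) =
      ((ν + k + d + 1).factorial : ℝ) := by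
    rw [← Real.Gamma_nat_eq_factorial]
    push_cast
    ring_nf
  have hΓ₃ : Real.Gamma ((ν + k : ℕ) + 1 / 2 + (2 * ((d + 1 : ℕ) : ℝ) - 1) / 2 + ν + 1) =
      ((d + (k + (2 * ν + 1))).factorial : ℝ) := by
    rw [← Real.Gamma_nat_eq_factorial]
    push_cast
    ring_nf
  have hΓ₄ : Real.Gamma ((d + 1 : ℕ) : ℝ) = (d.factorial : ℝ) := by
    rw [← Real.Gamma_nat_eq_factorial]
    push_cast
    rfl
  rw [hΓ₁, hΓ₂, hΓ₃, hΓ₄,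
    show (1 / 2 + (ν + k : ℕ) + 1 : ℝ) = (ν + k : ℕ) + 3 / 2 by ring,
    show (1 / 2 + ν + 1 : ℝ) = ν + 3 / 2 by ring,
    show (1 - 2 * x₀ ^ 2 / (x₀ ^ 2 + v ^ 2) - 1) / 2 = -x₀ ^ 2 / (x₀ ^ 2 + v ^ 2) by ring]
  have hG : Real.Gamma ((ν + k : ℕ) + 3 / 2 : ℝ) ≠ 0 := (Real.Gamma_pos_of_pos (by positivity)).ne'
  have hGν : Real.Gamma (ν + 3 / 2 : ℝ) ≠ 0 := (Real.Gamma_pos_of_pos (by positivity)).ne'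
  have hπ := Real.Gamma_nat_add_three_half ν
  have hsqrt : Real.sqrt Real.pi =
      Real.Gamma (ν + 3 / 2) * (2 ^ (2 * ν + 1) * ν.factorial) / (2 * ν + 1).factorial := by
    rw [hπ]
    field_simp
  have hsign : ((-1 : ℝ) ^ ν) ^ 2 = 1 := by rw [← pow_mul, mul_comm, pow_mul]; simp
  rw [hsqrt, neg_pow (x₀ ^ 2 + v ^ 2) k, div_pow, neg_pow (x₀ ^ 2) ν]
  generalize Real.Gamma ((ν + k : ℕ) + 3 / 2 : ℝ) = G at *
  generalize Real.Gamma (ν + 3 / 2 : ℝ) = Gν at *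
  generalize x₀ ^ 2 + v ^ 2 = p at *
  rw [pow_add p, pow_add (-1 : ℝ), mul_pow]
  field_simp
  rw [hsign]
  ring
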